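/- For every natural number n, there is an isomorphism of ℂ-algebras ℂ ⊗_ℝ CLIF(ℝ^{2n}) ≅ M_{2ⁿ}(ℂ), the algebra of 2ⁿ×2ⁿ complex matrices. -/

import Mathlib

open scoped RealInnerProductSpace TensorProduct

namespace CliffordAlgebra

section Hyperbolic

variable {R V : Type*} [CommRing R] [AddCommGroup V] [Module R V] (Q : QuadraticForm R V)

/-- The hyperbolic plane `(a, b) ↦ a * b`. -/
abbrev hyperbolicPlane (R : Type*) [CommRing R] : QuadraticForm R (R × R) :=
  QuadraticMap.linMulLin (LinearMap.fst R R R) (LinearMap.snd R R R)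

/-- The linear map `(v, a, b) ↦ !![v, a; b, -v]`. -/
def prodHyperbolicToMatrixAux : V × R × R →ₗ[R] Matrix (Fin 2) (Fin 2) (CliffordAlgebra Q) where
  toFun p := !![ι Q p.1, algebraMap R _ p.2.1; algebraMap R _ p.2.2, -ι Q p.1]
  map_add' p q := by
    ext i j; fin_cases i <;> fin_cases j <;> simp [add_comm]
  map_smul' c p := by
    ext i j; fin_cases i <;> fin_cases j <;> simp [Algebra.smul_def]

/-- The algebra map sending `(v, a, b)` to `!![v, a; b, -v]`. -/
def prodHyperbolicToMatrix :
    CliffordAlgebra (Q.prod (hyperbolicPlane R)) →ₐ[R]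
      Matrix (Fin 2) (Fin 2) (CliffordAlgebra Q) :=
  lift _ ⟨prodHyperbolicToMatrixAux Q, fun p => by
    ext i j
    fin_cases i <;> fin_cases j <;>
      simp [prodHyperbolicToMatrixAux, Matrix.mul_apply, Matrix.algebraMap_matrix_apply,
        Algebra.commutes, mul_comm p.2.2 p.2.1, ← map_mul, add_comm]⟩

theorem prodHyperbolicToMatrix_ι (p : V × R × R) :
    prodHyperbolicToMatrix Q (ι _ p) =
      !![ι Q p.1, algebraMap R _ p.2.1; algebraMap R _ p.2.2, -ι Q p.1] :=
  lift_ι_apply _ _ _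

/-- The first isotropic generator of the hyperbolic plane. -/
def hyperbolicX : CliffordAlgebra (Q.prod (hyperbolicPlane R)) := ι _ (0, 1, 0)

/-- The second isotropic generator of the hyperbolic plane. -/
def hyperbolicY : CliffordAlgebra (Q.prod (hyperbolicPlane R)) := ι _ (0, 0, 1)

theorem hyperbolicX_mul_self : hyperbolicX Q * hyperbolicX Q = 0 := by
  simp [hyperbolicX, ι_sq_scalar]

theorem hyperbolicY_mul_self : hyperbolicY Q * hyperbolicY Q = 0 := by
  simp [hyperbolicY, ι_sq_scalar]

theorem hyperbolicY_mul_hyperbolicX :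
    hyperbolicY Q * hyperbolicX Q = 1 - hyperbolicX Q * hyperbolicY Q := by
  rw [eq_sub_iff_add_eq, hyperbolicX, hyperbolicY, ι_mul_ι_add_swap]
  simp [QuadraticMap.polar]

theorem hyperbolicX_mul_ι (v : V) :
    hyperbolicX Q * ι _ (v, 0) = -(ι _ (v, 0) * hyperbolicX Q) := by
  rw [eq_neg_iff_add_eq_zero, hyperbolicX, ι_mul_ι_add_swap]
  simp [QuadraticMap.polar]

theorem hyperbolicY_mul_ι (v : V) :
    hyperbolicY Q * ι _ (v, 0) = -(ι _ (v, 0) * hyperbolicY Q) := by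
  rw [eq_neg_iff_add_eq_zero, hyperbolicY, ι_mul_ι_add_swap]
  simp [QuadraticMap.polar]

theorem hyperbolicX_mul_Y_mul_X :
    hyperbolicX Q * (hyperbolicY Q * hyperbolicX Q) = hyperbolicX Q := by
  rw [hyperbolicY_mul_hyperbolicX, mul_sub, ← mul_assoc, hyperbolicX_mul_self]; simp

theorem hyperbolicY_mul_X_mul_Y :
    hyperbolicY Q * (hyperbolicX Q * hyperbolicY Q) = hyperbolicY Q := by
  rw [← mul_assoc, hyperbolicY_mul_hyperbolicX, sub_mul, mul_assoc, hyperbolicY_mul_self]; simp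

/-- The involution `xy - yx` by which the vectors of `V` are twisted to commute with `x`, `y`. -/
def hyperbolicSign : CliffordAlgebra (Q.prod (hyperbolicPlane R)) :=
  hyperbolicX Q * hyperbolicY Q - hyperbolicY Q * hyperbolicX Q

theorem hyperbolicX_mul_sign : hyperbolicX Q * hyperbolicSign Q = -hyperbolicX Q := by
  rw [hyperbolicSign, mul_sub, ← mul_assoc, hyperbolicX_mul_self, hyperbolicX_mul_Y_mul_X,
    zero_mul, zero_sub]

theorem hyperbolicSign_mul_X : hyperbolicSign Q * hyperbolicX Q = hyperbolicX Q := by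
  rw [hyperbolicSign, sub_mul, mul_assoc, mul_assoc, hyperbolicX_mul_self,
    hyperbolicX_mul_Y_mul_X, mul_zero, sub_zero]

theorem hyperbolicY_mul_sign : hyperbolicY Q * hyperbolicSign Q = hyperbolicY Q := by
  rw [hyperbolicSign, mul_sub, ← mul_assoc _ _ (hyperbolicX Q), hyperbolicY_mul_self,
    hyperbolicY_mul_X_mul_Y, zero_mul, sub_zero]

theorem hyperbolicSign_mul_Y : hyperbolicSign Q * hyperbolicY Q = -hyperbolicY Q := by
  rw [hyperbolicSign, sub_mul, mul_assoc, mul_assoc, hyperbolicY_mul_self,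
    hyperbolicY_mul_X_mul_Y, mul_zero, zero_sub]

theorem hyperbolicSign_mul_self : hyperbolicSign Q * hyperbolicSign Q = 1 := by
  conv_lhs => rw [hyperbolicSign.eq_1 Q, mul_sub, ← hyperbolicSign, ← mul_assoc, ← mul_assoc,
    hyperbolicSign_mul_X, hyperbolicSign_mul_Y, neg_mul, hyperbolicY_mul_hyperbolicX]
  abel

theorem hyperbolicSign_mul_ι (v : V) :
    hyperbolicSign Q * ι _ (v, 0) = ι _ (v, 0) * hyperbolicSign Q := by
  have hx := hyperbolicX_mul_ι Q v
  have hy := hyperbolicY_mul_ι Q v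
  rw [hyperbolicSign, sub_mul, mul_assoc, mul_assoc, hx, hy, mul_neg, mul_neg, ← mul_assoc,
    ← mul_assoc, hx, hy, mul_sub]
  simp only [neg_mul, neg_neg, mul_assoc]

/-- The embedding of `CliffordAlgebra Q` onto the centralizer of the hyperbolic generators. -/
def twistedInl : CliffordAlgebra Q →ₐ[R] CliffordAlgebra (Q.prod (hyperbolicPlane R)) :=
  lift Q ⟨LinearMap.mulRight R (hyperbolicSign Q) ∘ₗ ι _ ∘ₗ LinearMap.inl R V (R × R), fun v => by
    have h : ι (Q.prod (hyperbolicPlane R)) (v, 0) * ι _ (v, 0) = algebraMap R _ (Q v) := by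
      simp [ι_sq_scalar]
    simp only [LinearMap.comp_apply, LinearMap.mulRight_apply, LinearMap.inl_apply]
    rw [mul_assoc, ← mul_assoc (hyperbolicSign Q), hyperbolicSign_mul_ι, mul_assoc,
      hyperbolicSign_mul_self, mul_one, h]⟩

theorem twistedInl_ι (v : V) : twistedInl Q (ι Q v) = ι _ (v, 0) * hyperbolicSign Q :=
  lift_ι_apply _ _ _

theorem commute_of_commute_ι {A : Type*} [Ring A] [Algebra R A] (f : CliffordAlgebra Q →ₐ[R] A)
    {z : A} (h : ∀ v, Commute z (f (ι Q v))) (a : CliffordAlgebra Q) : Commute z (f a) := by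
  induction a using CliffordAlgebra.induction with
  | algebraMap r => rw [AlgHom.commutes]; exact Algebra.commute_algebraMap_right r z
  | ι v => exact h v
  | mul a b ha hb => rw [map_mul]; exact ha.mul_right hb
  | add a b ha hb => rw [map_add]; exact ha.add_right hb

theorem commute_hyperbolicX_twistedInl (a : CliffordAlgebra Q) :
    Commute (hyperbolicX Q) (twistedInl Q a) := by
  refine commute_of_commute_ι Q _ (fun v => ?_) a
  rw [twistedInl_ι, Commute, SemiconjBy, ← mul_assoc, hyperbolicX_mul_ι, neg_mul, mul_assoc,
    hyperbolicX_mul_sign, mul_assoc, hyperbolicSign_mul_X, mul_neg, neg_neg]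

theorem commute_hyperbolicY_twistedInl (a : CliffordAlgebra Q) :
    Commute (hyperbolicY Q) (twistedInl Q a) := by
  refine commute_of_commute_ι Q _ (fun v => ?_) a
  rw [twistedInl_ι, Commute, SemiconjBy, ← mul_assoc, hyperbolicY_mul_ι, neg_mul, mul_assoc,
    hyperbolicY_mul_sign, mul_assoc, hyperbolicSign_mul_Y, mul_neg]

/-- The inverse of `prodHyperbolicToMatrix`. -/
def matrixToProdHyperbolic :
    Matrix (Fin 2) (Fin 2) (CliffordAlgebra Q) →ₐ[R]
      CliffordAlgebra (Q.prod (hyperbolicPlane R)) :=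
  AlgHom.ofLinearMap
    { toFun M := twistedInl Q (M 0 0) * (hyperbolicX Q * hyperbolicY Q)
        + twistedInl Q (M 0 1) * hyperbolicX Q + twistedInl Q (M 1 0) * hyperbolicY Q
        + twistedInl Q (M 1 1) * (hyperbolicY Q * hyperbolicX Q)
      map_add' M N := by simp only [Matrix.add_apply, map_add, add_mul]; abel
      map_smul' c M := by simp [smul_add] }
    (by simp [hyperbolicY_mul_hyperbolicX])
    (fun M N => by
      have key (a b s t) (h : Commute s (twistedInl Q b)) :
          twistedInl Q a * s * (twistedInl Q b * t) = twistedInl Q (a * b) * (s * t) := by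
        rw [map_mul, mul_assoc, ← mul_assoc s, h.eq]; simp only [mul_assoc]
      have hX := commute_hyperbolicX_twistedInl Q
      have hY := commute_hyperbolicY_twistedInl Q
      have hXY b := (hX b).mul_left (hY b)
      have hYX b := (hY b).mul_left (hX b)
      have hx := hyperbolicX_mul_self Q
      have hy := hyperbolicY_mul_self Q
      have hx' z : hyperbolicX Q * (hyperbolicX Q * z) = 0 := by rw [← mul_assoc, hx, zero_mul]
      have hy' z : hyperbolicY Q * (hyperbolicY Q * z) = 0 := by rw [← mul_assoc, hy, zero_mul]
      simp only [LinearMap.coe_mk, AddHom.coe_mk, Matrix.mul_apply, Fin.sum_univ_two, mul_add,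
        add_mul, key _ _ _ _ (hX _), key _ _ _ _ (hY _), key _ _ _ _ (hXY _), key _ _ _ _ (hYX _)]
      simp only [mul_assoc, hx, hy, hx', hy', hyperbolicX_mul_Y_mul_X, hyperbolicY_mul_X_mul_Y,
        mul_zero, add_zero, zero_add, map_add, add_mul]
      abel)

theorem matrixToProdHyperbolic_apply (M : Matrix (Fin 2) (Fin 2) (CliffordAlgebra Q)) :
    matrixToProdHyperbolic Q M = twistedInl Q (M 0 0) * (hyperbolicX Q * hyperbolicY Q)
        + twistedInl Q (M 0 1) * hyperbolicX Q + twistedInl Q (M 1 0) * hyperbolicY Q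
        + twistedInl Q (M 1 1) * (hyperbolicY Q * hyperbolicX Q) :=
  rfl

theorem prodHyperbolicToMatrix_twistedInl (a : CliffordAlgebra Q) :
    prodHyperbolicToMatrix Q (twistedInl Q a) = Matrix.scalar (Fin 2) a := by
  have h : (prodHyperbolicToMatrix Q).comp (twistedInl Q) = Matrix.scalarAlgHom (Fin 2) R := by
    ext v i j
    fin_cases i <;> fin_cases j <;>
      simp [twistedInl_ι, prodHyperbolicToMatrix_ι, hyperbolicSign, hyperbolicX, hyperbolicY]
  exact DFunLike.congr_fun h a

/-- Adding a hyperbolic plane to a quadratic form replaces its Clifford algebra by the algebra of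
`2 × 2` matrices over it. -/
def prodHyperbolicEquiv :
    CliffordAlgebra (Q.prod (hyperbolicPlane R)) ≃ₐ[R]
      Matrix (Fin 2) (Fin 2) (CliffordAlgebra Q) :=
  AlgEquiv.ofAlgHom (prodHyperbolicToMatrix Q) (matrixToProdHyperbolic Q)
    (by
      ext M i j
      fin_cases i <;> fin_cases j <;>
        simp [matrixToProdHyperbolic_apply, prodHyperbolicToMatrix_twistedInl,
          hyperbolicX, hyperbolicY, prodHyperbolicToMatrix_ι])
    (by
      ext v
      · have h : ι (Q.prod (hyperbolicPlane R)) (v, 0) * hyperbolicSign Q *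
            (hyperbolicX Q * hyperbolicY Q - hyperbolicY Q * hyperbolicX Q) = ι _ (v, 0) := by
          rw [← hyperbolicSign.eq_1, mul_assoc, hyperbolicSign_mul_self, mul_one]
        simpa [matrixToProdHyperbolic_apply, prodHyperbolicToMatrix_ι, twistedInl_ι, mul_add,
          sub_eq_add_neg] using h
      · simp [matrixToProdHyperbolic_apply, prodHyperbolicToMatrix_ι, hyperbolicX]
      · simp [matrixToProdHyperbolic_apply, prodHyperbolicToMatrix_ι, hyperbolicY])

end Hyperbolic

section SumSquares

open QuadraticMap

/-- Over a field with a square root `i` of `-1`, a sum of `m + 2` squares is a sum of `m` squares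
plus a hyperbolic plane. -/
def sumSquaresIsometryEquivProdHyperbolic {K : Type*} [Field K] [NeZero (2 : K)] {i : K}
    (hi : i * i = -1) (m : ℕ) :
    (weightedSumSquares K (1 : Fin (m + 2) → K)).IsometryEquiv
      ((weightedSumSquares K (1 : Fin m → K)).prod (hyperbolicPlane K)) where
  toFun v := (fun j => v j.succ.succ, v 0 + i * v 1, v 0 - i * v 1)
  invFun p := Fin.cons ((p.2.1 + p.2.2) / 2) (Fin.cons (i * (p.2.2 - p.2.1) / 2) p.1)
  map_add' v w := by ext <;> simp <;> ring
  map_smul' c v := by ext <;> simp <;> ring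
  left_inv v := by
    have h2 : (2 : K) ≠ 0 := two_ne_zero
    ext j
    refine Fin.cases ?_ (Fin.cases ?_ fun j => ?_) j
    · simp only [Fin.cons_zero]; field_simp; ring
    · dsimp only
      rw [Fin.cons_succ, Fin.cons_zero, Fin.succ_zero_eq_one]
      field_simp
      linear_combination (-2 * v 1) * hi
    · simp
  right_inv p := by
    have h2 : (2 : K) ≠ 0 := two_ne_zero
    ext j
    · simp
    · simp only [Fin.cons_zero, Fin.cons_one]
      field_simp
      linear_combination (p.2.2 - p.2.1) * hi
    · simp only [Fin.cons_zero, Fin.cons_one]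
      field_simp
      linear_combination (p.2.1 - p.2.2) * hi
  map_app' v := by
    simp only [prod_apply, weightedSumSquares_apply, linMulLin_apply, LinearMap.fst_apply,
      LinearMap.snd_apply, Fin.sum_univ_succ, Pi.one_apply, one_smul, Fin.succ_zero_eq_one]
    linear_combination (-(v 1 * v 1)) * hi

/-- Over a field with a square root of `-1`, the Clifford algebra of a sum of `2n` squares is the
algebra of `2ⁿ × 2ⁿ` matrices. -/
theorem nonempty_algEquiv_matrix_of_sumSquares {K : Type*} [Field K] [NeZero (2 : K)] {i : K}
    (hi : i * i = -1) (n : ℕ) :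
    Nonempty (CliffordAlgebra (weightedSumSquares K (1 : Fin (2 * n) → K)) ≃ₐ[K]
      Matrix (Fin (2 ^ n)) (Fin (2 ^ n)) K) := by
  induction n with
  | zero =>
    have : IsEmpty (Fin (2 * 0)) := Fin.isEmpty'
    let e : (weightedSumSquares K (1 : Fin (2 * 0) → K)).IsometryEquiv
        (0 : QuadraticForm K Unit) := ⟨0, fun v => by simp [weightedSumSquares_apply]⟩
    let f : K ≃ₐ[K] Matrix (Fin 1) (Fin 1) K :=
      AlgEquiv.ofBijective (Algebra.ofId K _) ⟨(algebraMap K _).injective, fun M =>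
        ⟨M 0 0, by ext j k; simp [Algebra.ofId_apply, Subsingleton.elim j 0, Subsingleton.elim k 0,
          Matrix.algebraMap_matrix_apply]⟩⟩
    exact ⟨(equivOfIsometry e).trans <| CliffordAlgebraRing.equiv.trans <| f.trans <|
      Matrix.reindexAlgEquiv K K (finCongr (pow_zero 2).symm)⟩
  | succ n ih =>
    obtain ⟨e⟩ := ih
    exact ⟨(equivOfIsometry (sumSquaresIsometryEquivProdHyperbolic hi (2 * n))).trans <|
      (prodHyperbolicEquiv _).trans <| e.mapMatrix.trans <|
      (Matrix.compAlgEquiv (Fin 2) (Fin (2 ^ n)) K K).trans <|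
      Matrix.reindexAlgEquiv K K (finProdFinEquiv.trans (finCongr (by ring)))⟩

/-- The complexification of the negative euclidean form is a sum of squares. -/
theorem equivalent_baseChange_sumSquares {m : ℕ} (Q : QuadraticForm ℝ (EuclideanSpace ℝ (Fin m)))
    (hQ : ∀ x : EuclideanSpace ℝ (Fin m), Q x = -⟪x, x⟫) :
    (Q.baseChange ℂ).Equivalent (weightedSumSquares ℂ (1 : Fin m → ℂ)) := by
  let b := (EuclideanSpace.basisFun (Fin m) ℝ).toBasis.baseChange ℂ
  let e := b.equivFun.trans (LinearEquiv.smulOfNeZero ℂ (Fin m → ℂ) Complex.I Complex.I_ne_zero)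
  have h : (weightedSumSquares ℂ (1 : Fin m → ℂ)).comp e.toLinearMap = Q.baseChange ℂ := by
    ext x
    have hI (z : ℂ) : Complex.I * z * (Complex.I * z) = -(z * z) := by
      linear_combination z * z * Complex.I_mul_I
    have hx : ((‖x‖ ^ 2 : ℝ) : ℂ) = ∑ j, (x j : ℂ) * x j := by
      rw [EuclideanSpace.real_norm_sq_eq]
      simp [pow_two]
    simp [e, b, hQ, weightedSumSquares_apply, hI, ← hx]
  exact ⟨⟨e, fun v => congr($h v)⟩⟩

end SumSquares

end CliffordAlgebra

/-- `ℂ ⊗ CLIF(ℝ^{2n}) ≅ M_{2ⁿ}(ℂ)` as `ℂ`-algebras, where `CLIF(ℝᵐ)` is the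
Clifford algebra of the negative euclidean form `Q(x) = -‖x‖²`. -/
theorem complexified_clifford_even_dim (n : ℕ)
    (Q : ∀ m : ℕ, QuadraticForm ℝ (EuclideanSpace ℝ (Fin m)))
    (hQ : ∀ (m : ℕ) (x : EuclideanSpace ℝ (Fin m)), Q m x = -⟪x, x⟫) :
    Nonempty ((ℂ ⊗[ℝ] CliffordAlgebra (Q (2 * n))) ≃ₐ[ℂ]
      Matrix (Fin (2 ^ n)) (Fin (2 ^ n)) ℂ) := by
  obtain ⟨e⟩ := CliffordAlgebra.equivalent_baseChange_sumSquares _ (hQ _)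
  obtain ⟨f⟩ := CliffordAlgebra.nonempty_algEquiv_matrix_of_sumSquares Complex.I_mul_I n
  exact ⟨(CliffordAlgebra.equivBaseChange ℂ _).symm.trans <|
    (CliffordAlgebra.equivOfIsometry e).trans f⟩
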